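/- For every natural number n, the number of permutations of length n in the juxtaposition class Av(312|21) equals the number of permutations of length n in the juxtaposition class Av(312|12). (There is a bijection φ : Av(312|21) → Av(312|12).) -/

import Mathlib

/-- `σ` contains an occurrence of the pattern `π` using only positions in `S`. -/
def ContainsIn {n m : ℕ} (σ : Equiv.Perm (Fin n)) (π : Equiv.Perm (Fin m))
    (S : Set (Fin n)) : Prop :=
  ∃ f : Fin m → Fin n, StrictMono f ∧ (∀ s, f s ∈ S) ∧
    ∀ s t : Fin m, σ (f s) < σ (f t) ↔ π s < π t

/-- `σ` contains an occurrence of the pattern `π`. -/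
def Contains {n m : ℕ} (σ : Equiv.Perm (Fin n)) (π : Equiv.Perm (Fin m)) : Prop :=
  ContainsIn σ π Set.univ

/-- `σ` avoids the pattern `π`. -/
def Avoids {n m : ℕ} (σ : Equiv.Perm (Fin n)) (π : Equiv.Perm (Fin m)) : Prop :=
  ¬ Contains σ π

/-- `σ` lies in the juxtaposition class `Av(P|Q)`: positions split at some cut `k`
(`0 ≤ k ≤ n`), no occurrence of `P` within the first `k` positions and no occurrence
of `Q` within the remaining positions. -/
def JuxtAv {n p q : ℕ} (P : Equiv.Perm (Fin p)) (Q : Equiv.Perm (Fin q))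
    (σ : Equiv.Perm (Fin n)) : Prop :=
  ∃ k ≤ n, ¬ ContainsIn σ P {i : Fin n | (i : ℕ) < k} ∧
    ¬ ContainsIn σ Q {i : Fin n | k ≤ (i : ℕ)}

noncomputable def p312 : Equiv.Perm (Fin 3) :=
  Equiv.ofBijective (![2,0,1] : Fin 3 → Fin 3) (by decide)

noncomputable def p21 : Equiv.Perm (Fin 2) :=
  Equiv.ofBijective (![1,0] : Fin 2 → Fin 2) (by decide)

noncomputable def p12 : Equiv.Perm (Fin 2) :=
  Equiv.ofBijective (![0,1] : Fin 2 → Fin 2) (by decide)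

open Finset in
theorem count_aux {α : Type*} [Fintype α] [DecidableEq α] (P Q : ℕ → α → Prop)
    (hP : ∀ k l x, k ≤ l → P l x → P k x) (hQ : ∀ k l x, k ≤ l → Q k x → Q l x) (n : ℕ) :
    Nat.card {x // ∃ k ≤ n, P k x ∧ Q k x} + ∑ k ∈ range n, Nat.card {x // P (k+1) x ∧ Q k x}
      = ∑ k ∈ range (n+1), Nat.card {x // P k x ∧ Q k x} := by
  classical
  induction n with
  | zero => simp
  | succ n ih =>
    rw [sum_range_succ, sum_range_succ _ (n+1), ← ih]
    have h := card_union_add_card_inter (univ.filter fun x => ∃ k ≤ n, P k x ∧ Q k x)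
      (univ.filter fun x => P (n+1) x ∧ Q (n+1) x)
    have e1 : (univ.filter fun x => ∃ k ≤ n, P k x ∧ Q k x) ∪
      (univ.filter fun x => P (n+1) x ∧ Q (n+1) x)
        = univ.filter fun x => ∃ k ≤ n+1, P k x ∧ Q k x := by
      ext x
      simp only [mem_union, mem_filter, mem_univ, true_and]
      constructor
      · rintro (⟨k, hk, h⟩ | h)
        · exact ⟨k, by omega, h⟩
        · exact ⟨n+1, le_rfl, h⟩
      · rintro ⟨k, hk, h⟩
        rcases Nat.lt_or_ge n k with h1 | h1
        · obtain rfl : k = n+1 := by omega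
          exact Or.inr h
        · exact Or.inl ⟨k, h1, h⟩
    have e2 : (univ.filter fun x => ∃ k ≤ n, P k x ∧ Q k x) ∩
      (univ.filter fun x => P (n+1) x ∧ Q (n+1) x)
        = univ.filter fun x => P (n+1) x ∧ Q n x := by
      ext x
      simp only [mem_inter, mem_filter, mem_univ, true_and]
      constructor
      · rintro ⟨⟨k, hk, h⟩, h'⟩
        exact ⟨h'.1, hQ _ _ _ hk h.2⟩
      · rintro ⟨h1, h2⟩
        exact ⟨⟨n, le_rfl, hP _ _ _ (Nat.le_succ n) h1, h2⟩, h1, hQ _ _ _ (Nat.le_succ n) h2⟩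
    rw [e1, e2] at h
    simp only [Nat.card_eq_fintype_card, Fintype.card_subtype] at h ⊢
    omega

/-- The first `k` positions avoid 312. -/
def PreAv {n : ℕ} (k : ℕ) (σ : Equiv.Perm (Fin n)) : Prop :=
  ∀ i j l : Fin n, i < j → j < l → (l : ℕ) < k → ¬ (σ j < σ l ∧ σ l < σ i)

/-- Positions from `k` on are increasing. -/
def SufInc {n : ℕ} (k : ℕ) (σ : Equiv.Perm (Fin n)) : Prop :=
  ∀ i j : Fin n, k ≤ (i : ℕ) → i < j → σ i < σ j

/-- Positions from `k` on are decreasing. -/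
def SufDec {n : ℕ} (k : ℕ) (σ : Equiv.Perm (Fin n)) : Prop :=
  ∀ i j : Fin n, k ≤ (i : ℕ) → i < j → σ j < σ i

theorem preAv_iff {n : ℕ} (k : ℕ) (σ : Equiv.Perm (Fin n)) :
    ¬ ContainsIn σ p312 {i : Fin n | (i : ℕ) < k} ↔ PreAv k σ := by
  constructor
  · intro h i j l hij hjl hl hh
    apply h
    refine ⟨![i, j, l], ?_, ?_, ?_⟩
    · intro s t hst
      fin_cases s <;> fin_cases t <;> simp at hst ⊢ <;> omega
    · intro s
      fin_cases s <;> simp <;> omega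
    · intro s t
      fin_cases s <;> fin_cases t <;> simp [p312] <;> omega
  · rintro h ⟨f, hf, hS, hp⟩
    refine h (f 0) (f 1) (f 2) (hf (by decide)) (hf (by decide)) (hS 2) ⟨?_, ?_⟩
    · rw [hp]; simp [p312]
    · rw [hp]; simp [p312]

theorem sufInc_iff {n : ℕ} (k : ℕ) (σ : Equiv.Perm (Fin n)) :
    ¬ ContainsIn σ p21 {i : Fin n | k ≤ (i : ℕ)} ↔ SufInc k σ := by
  constructor
  · intro h i j hi hij
    by_contra hh
    have hne : σ i ≠ σ j := fun e => absurd (σ.injective e) hij.ne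
    apply h
    refine ⟨![i, j], ?_, ?_, ?_⟩
    · intro s t hst
      fin_cases s <;> fin_cases t <;> simp at hst ⊢ <;> omega
    · intro s
      fin_cases s <;> simp <;> omega
    · intro s t
      fin_cases s <;> fin_cases t <;> simp [p21] <;> omega
  · rintro h ⟨f, hf, hS, hp⟩
    have h1 := h (f 0) (f 1) (hS 0) (hf (by decide))
    rw [hp] at h1
    simp [p21] at h1

theorem sufDec_iff {n : ℕ} (k : ℕ) (σ : Equiv.Perm (Fin n)) :
    ¬ ContainsIn σ p12 {i : Fin n | k ≤ (i : ℕ)} ↔ SufDec k σ := by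
  constructor
  · intro h i j hi hij
    by_contra hh
    have hne : σ i ≠ σ j := fun e => absurd (σ.injective e) hij.ne
    apply h
    refine ⟨![i, j], ?_, ?_, ?_⟩
    · intro s t hst
      fin_cases s <;> fin_cases t <;> simp at hst ⊢ <;> omega
    · intro s
      fin_cases s <;> simp <;> omega
    · intro s t
      fin_cases s <;> fin_cases t <;> simp [p12] <;> omega
  · rintro h ⟨f, hf, hS, hp⟩
    have h1 := h (f 0) (f 1) (hS 0) (hf (by decide))
    have h2 : σ (f 0) < σ (f 1) := by
      rw [hp]; simp [p12]
    exact absurd h1 h2.asymm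

/-- Reverse the positions from `k` on. -/
def revSuf (n k : ℕ) : Equiv.Perm (Fin n) where
  toFun i := if h : (i : ℕ) < k then i else ⟨n - 1 + k - i, by omega⟩
  invFun i := if h : (i : ℕ) < k then i else ⟨n - 1 + k - i, by omega⟩
  left_inv i := by
    apply Fin.ext
    by_cases h : (i : ℕ) < k
    · simp [h]
    · have : ¬ (n - 1 + k - (i : ℕ) < k) := by omega
      simp [h, this]; omega
  right_inv i := by
    apply Fin.ext
    by_cases h : (i : ℕ) < k
    · simp [h]
    · have : ¬ (n - 1 + k - (i : ℕ) < k) := by omega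
      simp [h, this]; omega

theorem revSuf_lt {n k : ℕ} (i : Fin n) (h : (i : ℕ) < k) : revSuf n k i = i := by
  simp [revSuf, h]

theorem revSuf_ge {n k : ℕ} (i : Fin n) (h : k ≤ (i : ℕ)) :
    (revSuf n k i : ℕ) = n - 1 + k - i := by
  simp [revSuf, Nat.not_lt.mpr h]

theorem revSuf_revSuf {n k : ℕ} (i : Fin n) : revSuf n k (revSuf n k i) = i :=
  (revSuf n k).left_inv i

theorem preAv_rev {n k : ℕ} (σ : Equiv.Perm (Fin n)) (h : PreAv k σ) :
    PreAv k ((revSuf n k).trans σ) := by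
  intro i j l hij hjl hl
  simp only [Equiv.trans_apply]
  rw [revSuf_lt i (by omega), revSuf_lt j (by omega), revSuf_lt l (by omega)]
  exact h i j l hij hjl hl

theorem card_G (n k : ℕ) : Nat.card {σ : Equiv.Perm (Fin n) // PreAv k σ ∧ SufInc k σ}
    = Nat.card {σ : Equiv.Perm (Fin n) // PreAv k σ ∧ SufDec k σ} := by
  have hinv : ∀ σ : Equiv.Perm (Fin n), (revSuf n k).trans ((revSuf n k).trans σ) = σ := by
    intro σ; ext i; simp [revSuf_revSuf]
  refine Nat.card_congr ⟨fun σ => ⟨(revSuf n k).trans σ.1, preAv_rev _ σ.2.1, ?_⟩,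
    fun σ => ⟨(revSuf n k).trans σ.1, preAv_rev _ σ.2.1, ?_⟩, ?_, ?_⟩
  · intro i j hi hij
    have h1 := revSuf_ge i hi
    have h2 := revSuf_ge j (k := k) (by omega)
    exact σ.2.2 _ _ (by omega) (by rw [Fin.lt_def]; omega)
  · intro i j hi hij
    have h1 := revSuf_ge i hi
    have h2 := revSuf_ge j (k := k) (by omega)
    exact σ.2.2 _ _ (by omega) (by rw [Fin.lt_def]; omega)
  · intro σ; exact Subtype.ext (hinv _)
  · intro σ; exact Subtype.ext (hinv _)

/-- Position map: rotate the first `k` positions by `a`, reverse those after `k`. -/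
def posMap (n k a : ℕ) (ha : a ≤ k) (hk : k < n) : Equiv.Perm (Fin n) where
  toFun i := if h1 : (i : ℕ) < k - a then ⟨i + a, by omega⟩ else
    if h2 : (i : ℕ) < k then ⟨i - (k - a), by omega⟩ else
    if h3 : (i : ℕ) = k then i else ⟨n + k - i, by omega⟩
  invFun i := if h1 : (i : ℕ) < a then ⟨i + (k - a), by omega⟩ else
    if h2 : (i : ℕ) < k then ⟨i - a, by omega⟩ else
    if h3 : (i : ℕ) = k then i else ⟨n + k - i, by omega⟩
  left_inv i := by
    apply Fin.ext
    grind
  right_inv i := by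
    apply Fin.ext
    grind

/-- Value map: exchange the values below and above `a`. -/
def valMap (n a : ℕ) (ha : a < n) : Equiv.Perm (Fin n) where
  toFun x := if h1 : (x : ℕ) < a then ⟨x + (n - a), by omega⟩ else
    if h2 : (x : ℕ) = a then ⟨n - 1 - a, by omega⟩ else ⟨x - (a + 1), by omega⟩
  invFun x := if h1 : (x : ℕ) < n - 1 - a then ⟨x + (a + 1), by omega⟩ else
    if h2 : (x : ℕ) = n - 1 - a then ⟨a, by omega⟩ else ⟨x - (n - a), by omega⟩
  left_inv i := by
    apply Fin.ext
    grind
  right_inv i := by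
    apply Fin.ext
    grind

theorem posMap_spec {n k a : ℕ} (ha : a ≤ k) (hk : k < n) (i : Fin n) :
    ((i : ℕ) < k - a ∧ (posMap n k a ha hk i : ℕ) = i + a) ∨
    (k - a ≤ (i : ℕ) ∧ (i : ℕ) < k ∧ (posMap n k a ha hk i : ℕ) = i - (k - a)) ∨
    ((i : ℕ) = k ∧ (posMap n k a ha hk i : ℕ) = k) ∨
    (k < (i : ℕ) ∧ (posMap n k a ha hk i : ℕ) = n + k - i) := by
  simp only [posMap, Equiv.coe_fn_mk]
  grind

theorem valMap_spec {n a : ℕ} (ha : a < n) (x : Fin n) :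
    ((x : ℕ) < a ∧ (valMap n a ha x : ℕ) = x + (n - a)) ∨
    ((x : ℕ) = a ∧ (valMap n a ha x : ℕ) = n - 1 - a) ∨
    (a < (x : ℕ) ∧ (valMap n a ha x : ℕ) = x - (a + 1)) := by
  simp only [valMap, Equiv.coe_fn_mk]
  grind

/-- Structure of the prefix: `a` small entries, then large, separated by value `v` at `k`. -/
structure Struct {n : ℕ} (k a v : ℕ) (σ : Equiv.Perm (Fin n)) : Prop where
  le : a ≤ k
  mid : ∀ i : Fin n, (i : ℕ) = k → (σ i : ℕ) = v
  low : ∀ i : Fin n, (i : ℕ) < a → (σ i : ℕ) < v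
  high : ∀ i : Fin n, a ≤ (i : ℕ) → (i : ℕ) < k → v < (σ i : ℕ)
  avl : ∀ i j l : Fin n, i < j → j < l → (l : ℕ) < a → ¬ (σ j < σ l ∧ σ l < σ i)
  avh : ∀ i j l : Fin n, i < j → j < l → a ≤ (i : ℕ) → (l : ℕ) < k → ¬ (σ j < σ l ∧ σ l < σ i)

theorem Struct.preAv {n k a v : ℕ} {σ : Equiv.Perm (Fin n)} (h : Struct k a v σ) :
    PreAv (k+1) σ := by
  intro i j l hij hjl hl hh
  have := h.le
  have hm := h.mid l
  have l1 := h.low i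
  have l2 := h.low j
  have l3 := h.low l
  have h1 := h.high i
  have h2 := h.high j
  have h3 := h.high l
  have h4 := h.avl i j l hij hjl
  have h5 := h.avh i j l hij hjl
  simp only [Fin.lt_def] at *
  by_cases c1 : (l : ℕ) < a
  · exact h4 c1 hh
  by_cases c2 : (l : ℕ) < k
  · by_cases c3 : a ≤ (i : ℕ)
    · exact h5 c3 c2 hh
    · omega
  · omega

open Finset in
theorem card_lt {n : ℕ} (σ : Equiv.Perm (Fin n)) (v : Fin n) :
    (univ.filter fun i => σ i < v).card = v := by
  have : (univ.filter fun i => σ i < v) = (Finset.Iio v).map σ.symm.toEmbedding := by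
    ext i; simp [Finset.mem_map_equiv]
  rw [this]; simp

open Finset in
theorem down_closed {n k c : ℕ} (S : Finset (Fin n)) (hk : k ≤ n) (hS : ∀ i ∈ S, (i : ℕ) < k)
    (hd : ∀ i j : Fin n, i < j → j ∈ S → i ∈ S) (hc : S.card = c) (i : Fin n) :
    i ∈ S ↔ (i : ℕ) < c := by
  constructor
  · intro hi
    have : Finset.Iic i ⊆ S := by
      intro j hj
      rcases (Finset.mem_Iic.mp hj).lt_or_eq with h | h
      · exact hd _ _ h hi
      · exact h ▸ hi
    have := card_le_card this
    simp at this
    omega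
  · intro hi
    by_contra hn
    have : S ⊆ Finset.Iio i := by
      intro j hj
      rw [Finset.mem_Iio]
      by_contra hij
      rcases (not_lt.mp hij).lt_or_eq with h | h
      · exact hn (hd _ _ h hj)
      · exact hn (h ▸ hj)
    have := card_le_card this
    simp at this
    omega

open Finset in
theorem struct_inc {n : ℕ} (k : Fin n) (a : Fin n) (σ : Equiv.Perm (Fin n)) :
    (σ k = a ∧ PreAv (k+1) σ ∧ SufInc k σ) ↔ (Struct k a a σ ∧ SufInc k σ) := by
  constructor
  · rintro ⟨h0, h1, h2⟩
    refine ⟨?_, h2⟩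
    have key := down_closed (k := k) (univ.filter fun i => σ i < a) (by omega)
      (by
        intro i hi
        simp only [mem_filter, mem_univ, true_and] at hi
        by_contra hik
        rcases (not_lt.mp hik).lt_or_eq with h | h
        · have := h2 k i le_rfl h
          omega
        · have : k = i := Fin.ext h
          subst this
          omega)
      (by
        intro i j hij hj
        simp only [mem_filter, mem_univ, true_and] at hj ⊢
        have hjk : j < k := by
          by_contra hik
          rcases (not_lt.mp hik).lt_or_eq with h | h
          · have := h2 k j le_rfl h
            omega
          · subst h
            omega
        by_contra hi
        have hne : σ i ≠ σ k := fun e => absurd (σ.injective e) (hij.trans hjk).ne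
        exact h1 i j k hij hjk (by omega) ⟨by omega, by omega⟩)
      (card_lt σ a)
    simp only [mem_filter, mem_univ, true_and] at key
    have hle : (a : ℕ) ≤ k := by
      have := key k
      omega
    refine ⟨hle, ?_, ?_, ?_, ?_, ?_⟩
    · intro i hi
      obtain rfl : i = k := Fin.ext hi
      rw [h0]
    · intro i hi
      exact (key i).2 hi
    · intro i hi hik
      have := key i
      have hne : σ i ≠ σ k := fun e => absurd (σ.injective e) (by omega)
      omega
    · intro i j l hij hjl hl
      exact h1 i j l hij hjl (by omega)
    · intro i j l hij hjl _ hl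
      exact h1 i j l hij hjl (by omega)
  · rintro ⟨h, h2⟩
    exact ⟨Fin.ext (h.mid k rfl), h.preAv, h2⟩

open Finset in
theorem struct_dec {n : ℕ} (k : Fin n) (a : Fin n) (σ : Equiv.Perm (Fin n)) :
    ((σ k).rev = a ∧ PreAv (k+1) σ ∧ SufDec k σ) ↔
      ((a : ℕ) ≤ k ∧ Struct k (k - a) (n - 1 - a) σ ∧ SufDec k σ) := by
  constructor
  · rintro ⟨h0, h1, h2⟩
    have hv : (σ k : ℕ) = n - 1 - a := by
      rw [← h0]; simp; omega
    have hge : ∀ j, σ k < σ j → j < k := by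
      intro j hj
      by_contra hik
      rcases (not_lt.mp hik).lt_or_eq with h | h
      · have := h2 k j le_rfl h
        omega
      · subst h
        omega
    have hcard : (univ.filter fun i => σ k < σ i).card = a := by
      have : (univ.filter fun i => σ k < σ i) = (Finset.Ioi (σ k)).map σ.symm.toEmbedding := by
        ext i; simp [Finset.mem_map_equiv]
      rw [this]; simp; omega
    have hsub : (univ.filter fun i => σ k < σ i) ⊆ Finset.Iio k := by
      intro j hj
      simp only [mem_filter, mem_univ, true_and] at hj
      exact Finset.mem_Iio.2 (hge j hj)
    have hle : (a : ℕ) ≤ k := by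
      have := card_le_card hsub
      simpa [hcard] using this
    have key := down_closed (k := k) (c := k - a)
      (Finset.Iio k \ univ.filter fun i => σ k < σ i) (by omega)
      (by
        intro i hi
        simp only [mem_sdiff, Finset.mem_Iio] at hi
        exact hi.1)
      (by
        intro i j hij hj
        simp only [mem_sdiff, Finset.mem_Iio, mem_filter, mem_univ, true_and] at hj ⊢
        refine ⟨hij.trans hj.1, fun hi => ?_⟩
        have hne : σ j ≠ σ k := fun e => absurd (σ.injective e) hj.1.ne
        exact h1 i j k hij hj.1 (by omega) ⟨by omega, by omega⟩)
      (by rw [card_sdiff_of_subset hsub, hcard]; simp)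
    simp only [mem_sdiff, Finset.mem_Iio, mem_filter, mem_univ, true_and] at key
    refine ⟨hle, ⟨by omega, ?_, ?_, ?_, ?_, ?_⟩, h2⟩
    · intro i hi
      obtain rfl : i = k := Fin.ext hi
      exact hv
    · intro i hi
      have := (key i).2 hi
      have hne : σ i ≠ σ k := fun e => absurd (σ.injective e) this.1.ne
      omega
    · intro i hi hik
      have := key i
      omega
    · intro i j l hij hjl hl
      exact h1 i j l hij hjl (by omega)
    · intro i j l hij hjl _ hl
      exact h1 i j l hij hjl (by omega)
  · rintro ⟨hle, h, h2⟩
    refine ⟨?_, h.preAv, h2⟩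
    have := h.mid k rfl
    apply Fin.ext
    simp
    omega

theorem main_iff {n : ℕ} (k a : Fin n) (ha : (a : ℕ) ≤ k) (σ : Equiv.Perm (Fin n)) :
    (Struct k a a σ ∧ SufInc k σ) ↔
    (Struct k (k - a) (n - 1 - a) (((posMap n k a ha k.2).trans σ).trans (valMap n a a.2)) ∧
      SufDec k (((posMap n k a ha k.2).trans σ).trans (valMap n a a.2))) := by
  set p := posMap n k a ha k.2 with hp
  have ps := posMap_spec ha k.2
  have vs := valMap_spec a.2
  rw [← hp] at ps
  have psi : ∀ i, _ := fun i => ps (p.symm i)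
  simp only [Equiv.apply_symm_apply] at psi
  constructor
  · rintro ⟨h, h2⟩
    have hm := h.mid k rfl
    have hbig : ∀ i : Fin n, (k : ℕ) < i → (a : ℕ) < σ i := by
      intro i hi
      have := h2 k i le_rfl hi
      omega
    have hb : ∀ i : Fin n, (i : ℕ) < k - a → (p i : ℕ) = i + a ∧ (a : ℕ) < σ (p i) ∧
        (valMap n a a.2 (σ (p i)) : ℕ) = σ (p i) - (a + 1) := by
      intro i hi
      have e : (p i : ℕ) = i + a := by have := ps i; omega
      have := h.high (p i) (by omega) (by omega)
      have := vs (σ (p i))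
      omega
    have hc : ∀ i : Fin n, k - a ≤ (i : ℕ) → (i : ℕ) < k → (p i : ℕ) = i - (k - a) ∧
        (σ (p i) : ℕ) < a ∧ (valMap n a a.2 (σ (p i)) : ℕ) = σ (p i) + (n - a) := by
      intro i hi hik
      have e : (p i : ℕ) = i - (k - a) := by have := ps i; omega
      have := h.low (p i) (by omega)
      have := vs (σ (p i))
      omega
    have hd : ∀ i : Fin n, (k : ℕ) < i → (p i : ℕ) = n + k - i ∧ (a : ℕ) < σ (p i) ∧
        (valMap n a a.2 (σ (p i)) : ℕ) = σ (p i) - (a + 1) := by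
      intro i hi
      have e : (p i : ℕ) = n + k - i := by have := ps i; omega
      have := hbig (p i) (by omega)
      have := vs (σ (p i))
      omega
    clear psi
    refine ⟨⟨by omega, ?_, ?_, ?_, ?_, ?_⟩, ?_⟩
    · intro i hi
      have := h.mid (p i)
      have := ps i
      have := vs (σ (p i))
      simp only [Equiv.trans_apply]
      omega
    · intro i hi
      have := h.high (p i)
      have := ps i
      have := vs (σ (p i))
      simp only [Equiv.trans_apply]
      omega
    · intro i hi hik
      have := h.low (p i)
      have := ps i
      have := vs (σ (p i))
      simp only [Equiv.trans_apply]
      omega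
    · intro i j l hij hjl hl hx
      simp only [Equiv.trans_apply, Fin.lt_def] at hx hij hjl
      have b1 := hb i (by omega)
      have b2 := hb j (by omega)
      have b3 := hb l hl
      exact h.avh (p i) (p j) (p l) (by rw [Fin.lt_def]; omega) (by rw [Fin.lt_def]; omega)
        (by omega) (by omega) ⟨by rw [Fin.lt_def]; omega, by rw [Fin.lt_def]; omega⟩
    · intro i j l hij hjl hi hl hx
      simp only [Equiv.trans_apply, Fin.lt_def] at hx hij hjl
      have b1 := hc i (by omega) (by omega)
      have b2 := hc j (by omega) (by omega)
      have b3 := hc l (by omega) (by omega)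
      exact h.avl (p i) (p j) (p l) (by rw [Fin.lt_def]; omega) (by rw [Fin.lt_def]; omega)
        (by omega) ⟨by rw [Fin.lt_def]; omega, by rw [Fin.lt_def]; omega⟩
    · intro i j hi hij
      simp only [Equiv.trans_apply, Fin.lt_def] at hij ⊢
      have b2 := hd j (by omega)
      rcases hi.lt_or_eq with hi | hi
      · have b1 := hd i hi
        have := h2 (p j) (p i) (by omega) (by rw [Fin.lt_def]; omega)
        rw [Fin.lt_def] at this
        omega
      · have b1 := h.mid (p i) (by have := ps i; omega)
        have := vs (σ (p i))
        omega
  · rintro ⟨h, h2⟩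
    have hm := h.mid
    have hl := h.low
    have hh := h.high
    have al := h.avl
    have ah := h.avh
    simp only [SufDec, Equiv.trans_apply] at hm hl hh al ah h2
    have hq : ∀ i, p (p.symm i) = i := fun i => p.apply_symm_apply i
    have hpk : p k = k := by
      apply Fin.ext
      have := ps k
      omega
    have hbig : ∀ i : Fin n, (k : ℕ) < i → (valMap n a a.2 (σ (p i)) : ℕ) < n - 1 - a := by
      intro i hi
      have := h2 k i le_rfl hi
      have := hm k rfl
      omega
    have hb : ∀ i : Fin n, (i : ℕ) < a → (p.symm i : ℕ) = i + (k - a) ∧ (σ i : ℕ) < a ∧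
        (valMap n a a.2 (σ i) : ℕ) = σ i + (n - a) := by
      intro i hi
      have e : (p.symm i : ℕ) = i + (k - a) := by have := psi i; omega
      have := hh (p.symm i) (by omega) (by omega)
      rw [hq] at this
      have := vs (σ i)
      omega
    have hc : ∀ i : Fin n, a ≤ (i : ℕ) → (i : ℕ) < k → (p.symm i : ℕ) = i - a ∧
        (a : ℕ) < σ i ∧ (valMap n a a.2 (σ i) : ℕ) = σ i - (a + 1) := by
      intro i hi hik
      have e : (p.symm i : ℕ) = i - a := by have := psi i; omega
      have := hl (p.symm i) (by omega)
      rw [hq] at this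
      have := vs (σ i)
      omega
    have hd : ∀ i : Fin n, (k : ℕ) < i → (p.symm i : ℕ) = n + k - i ∧ (a : ℕ) < σ i ∧
        (valMap n a a.2 (σ i) : ℕ) = σ i - (a + 1) := by
      intro i hi
      have e : (p.symm i : ℕ) = n + k - i := by have := psi i; omega
      have := hbig (p.symm i) (by omega)
      rw [hq] at this
      have := vs (σ i)
      omega
    refine ⟨⟨ha, ?_, ?_, ?_, ?_, ?_⟩, ?_⟩
    · intro i hi
      have b1 := hm (p.symm i) (by have := psi i; omega)
      rw [hq] at b1
      have := vs (σ i)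
      omega
    · intro i hi
      exact (hb i hi).2.1
    · intro i hi hik
      exact (hc i hi hik).2.1
    · intro i j l hij hjl hl' hx
      simp only [Fin.lt_def] at hx hij hjl
      have b1 := hb i (by omega)
      have b2 := hb j (by omega)
      have b3 := hb l hl'
      refine ah (p.symm i) (p.symm j) (p.symm l) (by rw [Fin.lt_def]; omega)
        (by rw [Fin.lt_def]; omega) (by omega) (by omega) ?_
      simp only [hq, Fin.lt_def]
      omega
    · intro i j l hij hjl hi hl' hx
      simp only [Fin.lt_def] at hx hij hjl
      have b1 := hc i (by omega) (by omega)
      have b2 := hc j (by omega) (by omega)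
      have b3 := hc l (by omega) (by omega)
      refine al (p.symm i) (p.symm j) (p.symm l) (by rw [Fin.lt_def]; omega)
        (by rw [Fin.lt_def]; omega) (by omega) ?_
      simp only [hq, Fin.lt_def]
      omega
    · intro i j hi hij
      simp only [Fin.lt_def] at hij ⊢
      have b2 := hd j (by omega)
      rcases hi.lt_or_eq with hi | hi
      · have b1 := hd i hi
        have := h2 (p.symm j) (p.symm i) (by omega) (by rw [Fin.lt_def]; omega)
        simp only [hq, Fin.lt_def] at this
        omega
      · have b1 := hm (p.symm i) (by have := psi i; omega)
        rw [hq] at b1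
        have := vs (σ i)
        omega

theorem card_fiber {n : ℕ} (k a : Fin n) :
    Nat.card {σ : Equiv.Perm (Fin n) // σ k = a ∧ PreAv (k+1) σ ∧ SufInc k σ} =
    Nat.card {σ : Equiv.Perm (Fin n) // (σ k).rev = a ∧ PreAv (k+1) σ ∧ SufDec k σ} := by
  simp only [struct_inc, struct_dec]
  by_cases ha : (a : ℕ) ≤ k
  · simp only [ha, true_and]
    let e : Equiv.Perm (Fin n) ≃ Equiv.Perm (Fin n) :=
      ⟨fun σ => ((posMap n k a ha k.2).trans σ).trans (valMap n a a.2),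
       fun σ => ((posMap n k a ha k.2).symm.trans σ).trans (valMap n a a.2).symm,
       fun σ => by ext i; simp, fun σ => by ext i; simp⟩
    exact Nat.card_congr (e.subtypeEquiv fun σ => main_iff k a ha σ)
  · have : ∀ σ : Equiv.Perm (Fin n), ¬ Struct k a a σ := fun σ h => ha h.le
    simp [ha, this]

open Finset in
theorem card_H {n : ℕ} (k : Fin n) :
    Nat.card {σ : Equiv.Perm (Fin n) // PreAv (k+1) σ ∧ SufInc k σ} =
    Nat.card {σ : Equiv.Perm (Fin n) // PreAv (k+1) σ ∧ SufDec k σ} := by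
  classical
  have h := fun a => card_fiber k a
  simp only [Nat.card_eq_fintype_card, Fintype.card_subtype] at h ⊢
  rw [card_eq_sum_card_fiberwise (f := fun σ => σ k) (t := univ) (by simp),
    card_eq_sum_card_fiberwise (s := univ.filter fun σ => PreAv (k+1) σ ∧ SufDec k σ)
      (f := fun σ => (σ k).rev) (t := univ) (by simp)]
  refine sum_congr rfl fun a _ => ?_
  simp only [filter_filter]
  simpa only [and_comm, and_left_comm, and_assoc] using h a

theorem stmt (n : ℕ) :
    Nat.card {σ : Equiv.Perm (Fin n) // JuxtAv p312 p21 σ}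
      = Nat.card {σ : Equiv.Perm (Fin n) // JuxtAv p312 p12 σ} := by
  classical
  have hP : ∀ k l (x : Equiv.Perm (Fin n)), k ≤ l → PreAv l x → PreAv k x :=
    fun k l x hkl h i j m h1 h2 h3 => h i j m h1 h2 (by omega)
  have h1 := count_aux (α := Equiv.Perm (Fin n)) PreAv SufInc hP
    (fun k l x hkl h i j h1 h2 => h i j (by omega) h2) n
  have h2 := count_aux (α := Equiv.Perm (Fin n)) PreAv SufDec hP
    (fun k l x hkl h i j h1 h2 => h i j (by omega) h2) n
  have h3 : ∑ k ∈ Finset.range n, Nat.card {σ : Equiv.Perm (Fin n) // PreAv (k+1) σ ∧ SufInc k σ}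
      = ∑ k ∈ Finset.range n, Nat.card {σ : Equiv.Perm (Fin n) // PreAv (k+1) σ ∧ SufDec k σ} :=
    Finset.sum_congr rfl
      (fun k hk => card_H (⟨k, Finset.mem_range.1 hk⟩ : Fin n))
  simp only [card_G] at h1
  simp only [JuxtAv, preAv_iff, sufInc_iff, sufDec_iff]
  omega
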